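/- Let T be a spanning tree of a finite connected weighted graph G rooted at r, and let e and e' be distinct tree edges with e' a descendant of e (Subtree(e') ⊊ Subtree(e)). Then F_e ∩ F_{e'} equals the set of edges {x, y} of G with one endpoint in Subtree(e') and the other endpoint outside Subtree(e). -/

import Mathlib

open SimpleGraph

/-- The crossing edges of the cut `S`: edges of `G` with exactly one endpoint in `S`. -/
def crossEdges {V : Type*} (G : SimpleGraph V) (S : Set V) : Set (Sym2 V) :=
  {f | f ∈ G.edgeSet ∧ ∃ x y, f = s(x, y) ∧ x ∈ S ∧ y ∉ S}

/-- The total weight of a set of edges. -/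
noncomputable def wSet {V : Type*} (w : Sym2 V → ℝ) (F : Set (Sym2 V)) : ℝ :=
  ∑ᶠ f ∈ F, w f

/-- The weight of the cut `S`. -/
noncomputable def cutWeight {V : Type*} (G : SimpleGraph V) (w : Sym2 V → ℝ) (S : Set V) : ℝ :=
  wSet w (crossEdges G S)

/-- The minimum cut weight of `G`: the minimum of `cutWeight` over all `S` with `∅ ⊊ S ⊊ V`. -/
noncomputable def minCut {V : Type*} (G : SimpleGraph V) (w : Sym2 V → ℝ) : ℝ :=
  sInf (cutWeight G w '' {S : Set V | S.Nonempty ∧ S ≠ Set.univ})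

/-- `F_e`: the set of edges `{x, y}` of `G` (tree and non-tree) whose unique path in `T`
between `x` and `y` contains the tree edge `e`. -/
def Fe {V : Type*} (G T : SimpleGraph V) (e : Sym2 V) : Set (Sym2 V) :=
  {f | f ∈ G.edgeSet ∧ ∃ x y, f = s(x, y) ∧ ∃ p : T.Walk x y, p.IsPath ∧ e ∈ p.edges}

/-- `Subtree(e)`: the vertices whose unique path in `T` to the root `r` passes through the
tree edge `e`; equivalently, the vertex set of the subtree of `T` rooted at the endpoint of
`e` farther from `r`. -/
def subtree {V : Type*} (T : SimpleGraph V) (r : V) (e : Sym2 V) : Set V :=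
  {x | ∃ p : T.Walk x r, p.IsPath ∧ e ∈ p.edges}

/-- A path of a tree avoids `e` iff its ends stay connected after deleting `e`. -/
lemma mem_path_iff {V : Type*} {T : SimpleGraph V} (hT : T.IsTree) (e : Sym2 V) (x y : V) :
    (∃ p : T.Walk x y, p.IsPath ∧ e ∈ p.edges) ↔ ¬ (T.deleteEdges {e}).Reachable x y := by
  classical
  constructor
  · rintro ⟨p, hp, he⟩ ⟨q⟩
    have hle : T.deleteEdges {e} ≤ T := T.deleteEdges_le {e}
    let q' : T.Path x y := ⟨q.bypass.mapLe hle, (q.bypass_isPath).mapLe hle⟩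
    have h := (hT.isAcyclic.subsingleton_path x y).elim ⟨p, hp⟩ q'
    have h2 : p = q.bypass.mapLe hle := congrArg Subtype.val h
    rw [h2] at he
    have he2 : e ∈ q.bypass.edges := by simpa using he
    have := q.bypass.edges_subset_edgeSet he2
    simp at this
  · intro h
    obtain ⟨p, hp⟩ := (hT.connected.preconnected x y).exists_isPath
    refine ⟨p, hp, ?_⟩
    by_contra hn
    exact h ⟨p.toDeleteEdges {e} (by rintro f hf rfl; exact hn hf)⟩

/-- After deleting `s(a, b)` from a connected graph, each vertex is connected to `a` or `b`. -/
lemma reach_or {V : Type*} {T : SimpleGraph V} (a b : V) {x : V} (p : T.Walk x a) :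
    (T.deleteEdges {s(a, b)}).Reachable x a ∨ (T.deleteEdges {s(a, b)}).Reachable x b := by
  suffices H : ∀ {x c : V} (_ : T.Walk x c), c = a →
      ((T.deleteEdges {s(a, b)}).Reachable x a ∨ (T.deleteEdges {s(a, b)}).Reachable x b) from
    H p rfl
  intro x c p
  induction p with
  | nil => rintro rfl; exact Or.inl (Reachable.refl _)
  | @cons u v w h p ih =>
    intro hc
    by_cases hs : s(u, v) = s(a, b)
    · rw [Sym2.eq_iff] at hs
      rcases hs with ⟨rfl, rfl⟩ | ⟨rfl, rfl⟩
      · exact Or.inl (Reachable.refl _)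
      · exact Or.inr (Reachable.refl _)
    · have hadj : (T.deleteEdges {s(a, b)}).Adj u v := by
        rw [deleteEdges_adj]; exact ⟨h, hs⟩
      exact (ih hc).imp hadj.reachable.trans hadj.reachable.trans

lemma path_iff_cross {V : Type*} {T : SimpleGraph V} (hT : T.IsTree) (r : V) (e : Sym2 V)
    (x y : V) :
    (∃ p : T.Walk x y, p.IsPath ∧ e ∈ p.edges) ↔
      ¬ (x ∈ subtree T r e ↔ y ∈ subtree T r e) := by
  unfold subtree
  simp only [Set.mem_setOf_eq, mem_path_iff hT]
  induction e using Sym2.ind with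
  | _ a b =>
  have R : ∀ z, (T.deleteEdges {s(a, b)}).Reachable z a ∨
      (T.deleteEdges {s(a, b)}).Reachable z b := fun z =>
    (hT.connected.preconnected z a).elim (reach_or a b)
  have tr : ∀ {u v w}, (T.deleteEdges {s(a, b)}).Reachable u v →
      (T.deleteEdges {s(a, b)}).Reachable v w → (T.deleteEdges {s(a, b)}).Reachable u w :=
    fun h k => h.trans k
  have sy : ∀ {u v}, (T.deleteEdges {s(a, b)}).Reachable u v →
      (T.deleteEdges {s(a, b)}).Reachable v u := fun h => h.symm
  generalize (T.deleteEdges {s(a, b)}).Reachable = Q at *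
  rw [not_iff_not, not_iff_not]
  constructor
  · exact fun h => ⟨fun k => tr (sy h) k, fun k => tr h k⟩
  · intro h
    by_cases hx : Q x r
    · exact tr hx (sy (h.1 hx))
    · have hy : ¬ Q y r := fun k => hx (h.2 k)
      rcases R x with h1 | h1 <;> rcases R y with h2 | h2 <;> rcases R r with h3 | h3 <;>
        first
        | exact tr h1 (sy h2)
        | exact absurd (tr h1 (sy h3)) hx
        | exact absurd (tr h2 (sy h3)) hy

lemma mem_Fe_iff {V : Type*} {G T : SimpleGraph V} (hT : T.IsTree) (r : V) (e : Sym2 V)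
    (x y : V) :
    s(x, y) ∈ Fe G T e ↔ s(x, y) ∈ G.edgeSet ∧
      ¬ (x ∈ subtree T r e ↔ y ∈ subtree T r e) := by
  unfold Fe
  simp only [Set.mem_setOf_eq, path_iff_cross hT r]
  refine and_congr_right fun _ => ⟨?_, fun h => ⟨x, y, rfl, h⟩⟩
  rintro ⟨u, v, huv, h⟩
  rw [Sym2.eq_iff] at huv
  rcases huv with ⟨rfl, rfl⟩ | ⟨rfl, rfl⟩
  · exact h
  · exact fun k => h k.symm

theorem stmt9 {V : Type*} [Fintype V] (G T : SimpleGraph V) (w : Sym2 V → ℝ)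
    (hw : ∀ f, 0 ≤ w f) (hG : G.Connected) (hTG : T ≤ G) (hT : T.IsTree)
    (r : V) (e e' : Sym2 V) (he : e ∈ T.edgeSet) (he' : e' ∈ T.edgeSet)
    (hne : e ≠ e') (hdesc : subtree T r e' ⊆ subtree T r e) :
    Fe G T e ∩ Fe G T e' =
      {f | f ∈ G.edgeSet ∧ ∃ x y : V, f = s(x, y) ∧
        x ∈ subtree T r e' ∧ y ∉ subtree T r e} := by
  ext f
  induction f using Sym2.ind with
  | _ x y =>
  rw [Set.mem_inter_iff, mem_Fe_iff hT r, mem_Fe_iff hT r, Set.mem_setOf_eq]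
  have dx := @hdesc x
  have dy := @hdesc y
  constructor
  · rintro ⟨⟨hg, h1⟩, -, h2⟩
    refine ⟨hg, ?_⟩
    by_cases hx : x ∈ subtree T r e'
    · exact ⟨x, y, rfl, hx, by tauto⟩
    · exact ⟨y, x, Sym2.eq_swap, by tauto, by tauto⟩
  · rintro ⟨hg, u, v, huv, hu, hv⟩
    rw [Sym2.eq_iff] at huv
    rcases huv with ⟨rfl, rfl⟩ | ⟨rfl, rfl⟩ <;> tauto
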